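/- For every C ⊆ {T, B, D} and every input nested sequent I, the proof-search algorithm Prove_C terminates on I; consequently the computation tree ct(I) is finite. -/

import Mathlib

/-! # Core definitions: intuitionistic tense logic, bi-relational semantics,
nested sequents (seq-trees), the calculus NIK_tC, proof search, computation
trees, morphisms and blueprints. -/

/-- Formulae of the tense language `𝓛`:
`A ::= p | ⊥ | A ∨ A | A ∧ A | A ⊃ A | ◇A | ◆A | □A | ■A`. -/
inductive Fml : Type where
  | atom : ℕ → Fml
  | bot  : Fml
  | or   : Fml → Fml → Fml
  | and  : Fml → Fml → Fml
  | imp  : Fml → Fml → Fml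
  | dia  : Fml → Fml   -- ◇ (forward diamond)
  | bdia : Fml → Fml   -- ◆ (backward diamond)
  | box  : Fml → Fml   -- □ (forward box)
  | bbox : Fml → Fml   -- ■ (backward box)
  deriving DecidableEq

namespace Fml

/-- Modal depth of a formula. -/
def mdep : Fml → ℕ
  | atom _ => 0
  | bot => 0
  | or A B => max A.mdep B.mdep
  | and A B => max A.mdep B.mdep
  | imp A B => max A.mdep B.mdep
  | dia A => A.mdep + 1
  | bdia A => A.mdep + 1
  | box A => A.mdep + 1
  | bbox A => A.mdep + 1

/-- The set of subformulae of a formula. -/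
def subf : Fml → Finset Fml
  | atom p => {atom p}
  | bot => {bot}
  | or A B => insert (or A B) (A.subf ∪ B.subf)
  | and A B => insert (and A B) (A.subf ∪ B.subf)
  | imp A B => insert (imp A B) (A.subf ∪ B.subf)
  | dia A => insert (dia A) A.subf
  | bdia A => insert (bdia A) A.subf
  | box A => insert (box A) A.subf
  | bbox A => insert (bbox A) A.subf

/-- `⟨x⟩`: the diamond determined by the direction `x` (`true` = forward `◇`,
`false` = backward `◆`). -/
def diaF : Bool → Fml → Fml
  | true, A => dia A
  | false, A => bdia A

/-- `[x]`: the box determined by the direction `x` (`true` = forward `□`,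
`false` = backward `■`). -/
def boxF : Bool → Fml → Fml
  | true, A => box A
  | false, A => bbox A

end Fml

/-- A bi-relational model `M = (W, ≤, R, V)`: `≤` is a pre-order, `R` satisfies
the confluence conditions (F1) and (F2), and `V` is monotone along `≤`. -/
structure Model where
  W : Type
  le : W → W → Prop
  R : W → W → Prop
  val : W → ℕ → Prop
  nonempty : Nonempty W
  le_refl : ∀ w, le w w
  le_trans : ∀ {w u v}, le w u → le u v → le w v
  F1 : ∀ {w w' v}, le w w' → R w v → ∃ v', R w' v' ∧ le v v'
  F2 : ∀ {w v v'}, R w v → le v v' → ∃ w', le w w' ∧ R w' v'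
  mono : ∀ {w u p}, le w u → val w p → val u p

/-- The satisfaction relation `M, w ⊨ A`. -/
def Model.Sat (M : Model) : M.W → Fml → Prop
  | w, .atom p => M.val w p
  | _, .bot => False
  | w, .or A B => M.Sat w A ∨ M.Sat w B
  | w, .and A B => M.Sat w A ∧ M.Sat w B
  | w, .imp A B => ∀ u, M.le w u → M.Sat u A → M.Sat u B
  | w, .dia A => ∃ u, M.R w u ∧ M.Sat u A
  | w, .bdia A => ∃ u, M.R u w ∧ M.Sat u A
  | w, .box A => ∀ u v, M.le w u → M.R u v → M.Sat v A
  | w, .bbox A => ∀ u v, M.le w u → M.R v u → M.Sat v A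

/-- `M` is based on a frame in the class `F_C`, where the subset
`C ⊆ {T, B, D}` is encoded by the three Boolean flags `ct`, `cb`, `cd`:
`R` is reflexive if `T ∈ C`, symmetric if `B ∈ C`, and serial if `D ∈ C`. -/
def Model.InClass (M : Model) (ct cb cd : Bool) : Prop :=
  (ct = true → ∀ w, M.R w w) ∧
  (cb = true → ∀ w u, M.R w u → M.R u w) ∧
  (cd = true → ∀ w, ∃ u, M.R w u)

/-- A Gentzen sequent `Γ ⊢ Δ` (finite sets of formulae). -/
abbrev GSeq : Type := Finset Fml × Finset Fml

/-- A seq-tree (equivalently, a nested sequent): a finite rooted tree whose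
vertices (names, drawn from `ℕ`) are labelled with Gentzen sequents and whose
edges are labelled with a direction (`true` = forward `•`, `false` =
backward `◦`). -/
structure SeqTree where
  verts : Finset ℕ
  root : ℕ
  edges : Finset (ℕ × ℕ)
  elabel : ℕ → ℕ → Bool
  vlab : ℕ → GSeq
  root_mem : root ∈ verts
  edges_sub : ∀ e ∈ edges, e.1 ∈ verts ∧ e.2 ∈ verts
  root_no_parent : ∀ u, (u, root) ∉ edges
  parent_unique : ∀ v ∈ verts, ∀ u u', (u, v) ∈ edges → (u', v) ∈ edges → u = u'
  connected : ∀ v ∈ verts, Relation.ReflTransGen (fun a b => (a, b) ∈ edges) root v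

namespace SeqTree

/-- The antecedent (input formulae) of the `w`-component. -/
def ant (T : SeqTree) (w : ℕ) : Finset Fml := (T.vlab w).1

/-- The consequent (output formulae) of the `w`-component. -/
def suc (T : SeqTree) (w : ℕ) : Finset Fml := (T.vlab w).2

/-- `T.AtDepth w k`: the component `w` occurs at depth `k` in `T`. -/
inductive AtDepth (T : SeqTree) : ℕ → ℕ → Prop where
  | root : T.AtDepth T.root 0
  | step {u v k} : T.AtDepth u k → (u, v) ∈ T.edges → T.AtDepth v (k + 1)

/-- `w` is a leaf of the seq-tree `T`. -/
def IsLeaf (T : SeqTree) (w : ℕ) : Prop := w ∈ T.verts ∧ ∀ u, (w, u) ∉ T.edges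

/-- The modal depth of a nested sequent: the maximum over components `w` at
depth `k` of `(modal depth of a formula at w) + k`. -/
noncomputable def mdep (T : SeqTree) : ℕ :=
  sSup {n | ∃ w ∈ T.verts, ∃ k, T.AtDepth w k ∧ ∃ A ∈ T.ant w ∪ T.suc w, n = A.mdep + k}

/-- `T ⊨ w ↠ₓ^C u`: the C-closure reachability relation of Definition 3.3,
with `C ⊆ {T,B}` encoded by the flags `ct`, `cb`. -/
def Reach (T : SeqTree) (ct cb : Bool) (x : Bool) (w u : ℕ) : Prop :=
  ((w, u) ∈ T.edges ∧ T.elabel w u = x) ∨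
  ((u, w) ∈ T.edges ∧ T.elabel u w = !x) ∨
  (ct = true ∧ w = u ∧ w ∈ T.verts) ∨
  (cb = true ∧ (((w, u) ∈ T.edges ∧ T.elabel w u = !x) ∨
                ((u, w) ∈ T.edges ∧ T.elabel u w = x)))

/-- All formulae occurring in `T`, together with their subformulae. -/
def subfs (T : SeqTree) : Finset Fml :=
  (T.verts.biUnion fun w => T.ant w ∪ T.suc w).biUnion Fml.subf

end SeqTree

/-- `M, ι ⊨ T`: satisfaction of a seq-tree on a model under an
`M`-interpretation `ι` (Definition 3.2): if every `•`-edge `(u,v)` satisfies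
`ι(u) R ι(v)` and every `◦`-edge `(u,v)` satisfies `ι(v) R ι(u)`, then some
component `v` satisfies `M, ι(v) ⊨ ⋀Γ ⊃ ⋁Δ`. -/
def Model.SatSeq (M : Model) (T : SeqTree) (ι : ℕ → M.W) : Prop :=
  (∀ e ∈ T.edges, (T.elabel e.1 e.2 = true → M.R (ι e.1) (ι e.2)) ∧
                  (T.elabel e.1 e.2 = false → M.R (ι e.2) (ι e.1))) →
  ∃ v ∈ T.verts, ∀ u, M.le (ι v) u →
    (∀ A ∈ T.ant v, M.Sat u A) → ∃ B ∈ T.suc v, M.Sat u B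

/-- A default (trivial) seq-tree. -/
def SeqTree.triv : SeqTree where
  verts := {0}
  root := 0
  edges := ∅
  elabel := fun _ _ => true
  vlab := fun _ => (∅, ∅)
  root_mem := Finset.mem_singleton_self 0
  edges_sub := by intro e he; simp at he
  root_no_parent := by intro u h; simp at h
  parent_unique := by intro v _ u u' h; simp at h
  connected := by
    intro v hv
    have hv0 : v = 0 := Finset.mem_singleton.mp hv
    subst hv0
    exact Relation.ReflTransGen.refl

instance : Inhabited SeqTree := ⟨SeqTree.triv⟩

/-- The nested sequent `⊢ A` consisting of a single component with empty
antecedent and consequent `{A}`. -/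
def singleSeq (A : Fml) : SeqTree where
  verts := {0}
  root := 0
  edges := ∅
  elabel := fun _ _ => true
  vlab := fun _ => (∅, {A})
  root_mem := Finset.mem_singleton_self 0
  edges_sub := by intro e he; simp at he
  root_no_parent := by intro u h; simp at h
  parent_unique := by intro v _ u u' h; simp at h
  connected := by
    intro v hv
    have hv0 : v = 0 := Finset.mem_singleton.mp hv
    subst hv0
    exact Relation.ReflTransGen.refl

/-! ## Morphisms between seq-trees -/

/-- A weak morphism between seq-trees: a root-preserving vertex map that
preserves edges and edge labels. -/
def WeakMorphism (T T' : SeqTree) (f : ℕ → ℕ) : Prop :=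
  (∀ v ∈ T.verts, f v ∈ T'.verts) ∧
  f T.root = T'.root ∧
  ∀ u v, (u, v) ∈ T.edges → (f u, f v) ∈ T'.edges ∧ T.elabel u v = T'.elabel (f u) (f v)

/-- A strong morphism: a weak morphism additionally preserving vertex labels. -/
def StrongMorphism (T T' : SeqTree) (f : ℕ → ℕ) : Prop :=
  WeakMorphism T T' f ∧ ∀ v ∈ T.verts, T.vlab v = T'.vlab (f v)

/-- Morphic equivalence `T ≃ T'`: strong morphisms exist in both directions. -/
def MorphEquiv (T T' : SeqTree) : Prop :=
  (∃ f, StrongMorphism T T' f) ∧ (∃ g, StrongMorphism T' T g)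

/-- `T ∈ S(I)`: all vertex labels of `T` are built from subformulae of `I`. -/
def InS (I T : SeqTree) : Prop := ∀ w ∈ T.verts, T.ant w ∪ T.suc w ⊆ I.subfs

/-- `T` has depth at most `k`. -/
def DepthLE (T : SeqTree) (k : ℕ) : Prop := ∀ v n, T.AtDepth v n → n ≤ k

/-! ## The rules of the calculus `NIK_tC` -/

/-- Two seq-trees share the same underlying shape (vertices, root, edges,
edge labels). -/
def sameShape (T T' : SeqTree) : Prop :=
  T'.verts = T.verts ∧ T'.root = T.root ∧ T'.edges = T.edges ∧ T'.elabel = T.elabel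

/-- `T'` is `T` with the label of the component `w` replaced by `s`. -/
def updAt (T : SeqTree) (w : ℕ) (s : GSeq) (T' : SeqTree) : Prop :=
  sameShape T T' ∧ T'.vlab = Function.update T.vlab w s

/-- `T'` is `T` extended with a fresh child `u` of `w`, over an edge labelled
`x`, with component label `s`. -/
def extendAt (T : SeqTree) (w u : ℕ) (x : Bool) (s : GSeq) (T' : SeqTree) : Prop :=
  w ∈ T.verts ∧ u ∉ T.verts ∧
  T'.verts = insert u T.verts ∧ T'.root = T.root ∧
  T'.edges = insert (w, u) T.edges ∧
  T'.elabel = (fun a b => if a = w ∧ b = u then x else T.elabel a b) ∧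
  T'.vlab = Function.update T.vlab u s

/-- The rule `∨L` (conclusion `T`, premises `T1`, `T2`). -/
def OrLRule (T : SeqTree) (w : ℕ) (A B : Fml) (T1 T2 : SeqTree) : Prop :=
  ∃ Γ, w ∈ T.verts ∧ T.ant w = insert (A.or B) Γ ∧
    updAt T w (insert A Γ, T.suc w) T1 ∧ updAt T w (insert B Γ, T.suc w) T2

/-- The rule `∨R`. -/
def OrRRule (T : SeqTree) (w : ℕ) (A B : Fml) (T' : SeqTree) : Prop :=
  ∃ Δ, w ∈ T.verts ∧ T.suc w = insert (A.or B) Δ ∧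
    updAt T w (T.ant w, insert A (insert B Δ)) T'

/-- The rule `∧L`. -/
def AndLRule (T : SeqTree) (w : ℕ) (A B : Fml) (T' : SeqTree) : Prop :=
  ∃ Γ, w ∈ T.verts ∧ T.ant w = insert (A.and B) Γ ∧
    updAt T w (insert A (insert B Γ), T.suc w) T'

/-- The rule `∧R`. -/
def AndRRule (T : SeqTree) (w : ℕ) (A B : Fml) (T1 T2 : SeqTree) : Prop :=
  ∃ Δ, w ∈ T.verts ∧ T.suc w = insert (A.and B) Δ ∧
    updAt T w (T.ant w, insert A Δ) T1 ∧ updAt T w (T.ant w, insert B Δ) T2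

/-- The rule `⊃L`. -/
def ImpLRule (T : SeqTree) (w : ℕ) (A B : Fml) (T1 T2 : SeqTree) : Prop :=
  ∃ Γ, w ∈ T.verts ∧ T.ant w = insert (A.imp B) Γ ∧
    updAt T w (T.ant w, insert A (T.suc w)) T1 ∧ updAt T w (insert B Γ, T.suc w) T2

/-- The (non-invertible) rule `⊃R`: all consequents of all other components are
deleted, and `A ⊢ B` is adjoined at `w`. -/
def ImpRRule (T : SeqTree) (w : ℕ) (A B : Fml) (T' : SeqTree) : Prop :=
  w ∈ T.verts ∧ A.imp B ∈ T.suc w ∧ sameShape T T' ∧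
  (∀ v, v ≠ w → T'.vlab v = (T.ant v, ∅)) ∧
  T'.vlab w = (insert A (T.ant w), {B})

/-- The rule `⟨x⟩L`: a fresh `x`-child containing `A` in its antecedent is
created. -/
def DiaLRule (T : SeqTree) (w u : ℕ) (x : Bool) (A : Fml) (T' : SeqTree) : Prop :=
  ∃ Γ, w ∈ T.verts ∧ u ∉ T.verts ∧ T.ant w = insert (Fml.diaF x A) Γ ∧
    T'.verts = insert u T.verts ∧ T'.root = T.root ∧
    T'.edges = insert (w, u) T.edges ∧
    T'.elabel = (fun a b => if a = w ∧ b = u then x else T.elabel a b) ∧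
    T'.vlab = fun v => if v = u then ({A}, ∅) else if v = w then (Γ, T.suc w) else T.vlab v

/-- The propagation rule `⟨x⟩R`, restricted by the C-closure reachability
relation `w ↠ₓ^C u`. -/
def DiaRRule (ct cb : Bool) (T : SeqTree) (w u : ℕ) (x : Bool) (A : Fml) (T' : SeqTree) : Prop :=
  w ∈ T.verts ∧ u ∈ T.verts ∧ Fml.diaF x A ∈ T.suc w ∧ T.Reach ct cb x w u ∧
  updAt T u (T.ant u, insert A (T.suc u)) T'

/-- The propagation rule `[x]L`, restricted by `w ↠ₓ^C u`. -/
def BoxLRule (ct cb : Bool) (T : SeqTree) (w u : ℕ) (x : Bool) (A : Fml) (T' : SeqTree) : Prop :=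
  w ∈ T.verts ∧ u ∈ T.verts ∧ Fml.boxF x A ∈ T.ant w ∧ T.Reach ct cb x w u ∧
  updAt T u (insert A (T.ant u), T.suc u) T'

/-- The (non-invertible) rule `[x]R`: all consequents are deleted and a fresh
`x`-child `⊢ A` is created. -/
def BoxRRule (T : SeqTree) (w u : ℕ) (x : Bool) (A : Fml) (T' : SeqTree) : Prop :=
  w ∈ T.verts ∧ u ∉ T.verts ∧ Fml.boxF x A ∈ T.suc w ∧
  T'.verts = insert u T.verts ∧ T'.root = T.root ∧
  T'.edges = insert (w, u) T.edges ∧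
  T'.elabel = (fun a b => if a = w ∧ b = u then x else T.elabel a b) ∧
  (∀ v ∈ T.verts, T'.vlab v = (T.ant v, ∅)) ∧
  T'.vlab u = (∅, {A})

/-- The rule `d`: an empty fresh `•`-child is adjoined. -/
def DRule (T : SeqTree) (w u : ℕ) (T' : SeqTree) : Prop :=
  extendAt T w u true (∅, ∅) T'

/-- Provability in the nested sequent calculus `NIK_tC`, where
`C ⊆ {T, B, D}` is encoded by the Boolean flags `ct`, `cb`, `cd`
(the rule `d` belongs to the calculus iff `D ∈ C`). -/
inductive Prov (ct cb cd : Bool) : SeqTree → Prop where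
  | id {T : SeqTree} {w p} : w ∈ T.verts → Fml.atom p ∈ T.ant w → Fml.atom p ∈ T.suc w →
      Prov ct cb cd T
  | botL {T : SeqTree} {w} : w ∈ T.verts → Fml.bot ∈ T.ant w → Prov ct cb cd T
  | orL {T w A B T1 T2} : OrLRule T w A B T1 T2 → Prov ct cb cd T1 → Prov ct cb cd T2 →
      Prov ct cb cd T
  | orR {T w A B T'} : OrRRule T w A B T' → Prov ct cb cd T' → Prov ct cb cd T
  | andL {T w A B T'} : AndLRule T w A B T' → Prov ct cb cd T' → Prov ct cb cd T
  | andR {T w A B T1 T2} : AndRRule T w A B T1 T2 → Prov ct cb cd T1 → Prov ct cb cd T2 →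
      Prov ct cb cd T
  | impL {T w A B T1 T2} : ImpLRule T w A B T1 T2 → Prov ct cb cd T1 → Prov ct cb cd T2 →
      Prov ct cb cd T
  | impR {T w A B T'} : ImpRRule T w A B T' → Prov ct cb cd T' → Prov ct cb cd T
  | diaL {T w u x A T'} : DiaLRule T w u x A T' → Prov ct cb cd T' → Prov ct cb cd T
  | diaR {T w u x A T'} : DiaRRule ct cb T w u x A T' → Prov ct cb cd T' → Prov ct cb cd T
  | boxL {T w u x A T'} : BoxLRule ct cb T w u x A T' → Prov ct cb cd T' → Prov ct cb cd T
  | boxR {T w u x A T'} : BoxRRule T w u x A T' → Prov ct cb cd T' → Prov ct cb cd T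
  | d {T w u T'} : cd = true → DRule T w u T' → Prov ct cb cd T' → Prov ct cb cd T

/-! ## Saturation, stability, initial sequents -/

/-- An initial sequent: some formula occurs among the input and output
formulae, or `⊥` occurs among the input formulae (lines 1–3 of `Prove_C`). -/
def InitialSeq (T : SeqTree) : Prop :=
  (∃ A : Fml, (∃ w ∈ T.verts, A ∈ T.ant w) ∧ (∃ u ∈ T.verts, A ∈ T.suc u)) ∨
  (∃ w ∈ T.verts, Fml.bot ∈ T.ant w)

/-- `C`-saturation of a seq-tree (Definition 4.2); `m` is the modal depth of
the input sequent `I` of the proof search (used by condition `(d)`). -/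
def Saturated (ct cb cd : Bool) (m : ℕ) (T : SeqTree) : Prop :=
  ∀ w ∈ T.verts,
    (∀ A : Fml, ¬ (A ∈ T.ant w ∧ A ∈ T.suc w)) ∧
    Fml.bot ∉ T.ant w ∧
    (∀ A B, A.or B ∈ T.ant w → A ∈ T.ant w ∨ B ∈ T.ant w) ∧
    (∀ A B, A.or B ∈ T.suc w → A ∈ T.suc w ∧ B ∈ T.suc w) ∧
    (∀ A B, A.and B ∈ T.ant w → A ∈ T.ant w ∧ B ∈ T.ant w) ∧
    (∀ A B, A.and B ∈ T.suc w → A ∈ T.suc w ∨ B ∈ T.suc w) ∧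
    (∀ A B, A.imp B ∈ T.ant w → A ∈ T.suc w ∨ B ∈ T.ant w) ∧
    (∀ x A, Fml.diaF x A ∈ T.ant w →
      ∃ u, (w, u) ∈ T.edges ∧ T.elabel w u = x ∧ A ∈ T.ant u) ∧
    (∀ x A u, Fml.diaF x A ∈ T.suc w → T.Reach ct cb x w u → A ∈ T.suc u) ∧
    (∀ x A u, Fml.boxF x A ∈ T.ant w → T.Reach ct cb x w u → A ∈ T.ant u) ∧
    (cd = true → ∀ k, T.AtDepth w k → k ≤ m →
      ∃ u, (w, u) ∈ T.edges ∧ T.elabel w u = true)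

/-- A stable seq-tree: saturated, with no output implications or boxes. -/
def StableSeq (ct cb cd : Bool) (m : ℕ) (T : SeqTree) : Prop :=
  Saturated ct cb cd m T ∧
  ∀ w ∈ T.verts, (∀ A B : Fml, A.imp B ∉ T.suc w) ∧
    (∀ A : Fml, Fml.box A ∉ T.suc w) ∧ (∀ A : Fml, Fml.bbox A ∉ T.suc w)

/-- `T` is a repeat relative to the list `hist` of its ancestors: it is
saturated and admits a strong morphism to some ancestor (its companion). -/
def Repeats (ct cb cd : Bool) (m : ℕ) (hist : List SeqTree) (T : SeqTree) : Prop :=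
  Saturated ct cb cd m T ∧ ∃ H ∈ hist, ∃ f, StrongMorphism T H f

/-- Proof search halts at `T` (relative to the ancestors `hist`): `T` is
initial, stable, or a repeat. -/
def Halted (ct cb cd : Bool) (m : ℕ) (hist : List SeqTree) (T : SeqTree) : Prop :=
  InitialSeq T ∨ StableSeq ct cb cd m T ∨ Repeats ct cb cd m hist T

/-! ## The proof-search steps of `Prove_C` -/

/-- Adjoin `A` to the antecedent of the `w`-component (the operation
`G ◁_w (A ⊢)`). -/
def addAnt (T : SeqTree) (w : ℕ) (A : Fml) (T' : SeqTree) : Prop :=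
  w ∈ T.verts ∧ updAt T w (insert A (T.ant w), T.suc w) T'

/-- Adjoin `A` to the consequent of the `w`-component (the operation
`G ◁_w (⊢ A)`). -/
def addSuc (T : SeqTree) (w : ℕ) (A : Fml) (T' : SeqTree) : Prop :=
  w ∈ T.verts ∧ updAt T w (T.ant w, insert A (T.suc w)) T'

/-- One (bottom-up, non-redundant) rule application performed by the
proof-search algorithm `Prove_C` on input of modal depth `m`, producing the
premise `T'` from `T`.  The disjunctive-branching rule `db` (simultaneous
`⊃R`/`[x]R` applications) is applied only to saturated sequents. -/
def AlgStep (ct cb cd : Bool) (m : ℕ) (T T' : SeqTree) : Prop :=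
  -- ∨L
  (∃ w A B, w ∈ T.verts ∧ Fml.or A B ∈ T.ant w ∧ A ∉ T.ant w ∧ B ∉ T.ant w ∧
    (addAnt T w A T' ∨ addAnt T w B T')) ∨
  -- ∨R
  (∃ w A B, w ∈ T.verts ∧ Fml.or A B ∈ T.suc w ∧ ¬ (A ∈ T.suc w ∧ B ∈ T.suc w) ∧
    updAt T w (T.ant w, insert A (insert B (T.suc w))) T') ∨
  -- ∧L
  (∃ w A B, w ∈ T.verts ∧ Fml.and A B ∈ T.ant w ∧ ¬ (A ∈ T.ant w ∧ B ∈ T.ant w) ∧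
    updAt T w (insert A (insert B (T.ant w)), T.suc w) T') ∨
  -- ∧R
  (∃ w A B, w ∈ T.verts ∧ Fml.and A B ∈ T.suc w ∧ A ∉ T.suc w ∧ B ∉ T.suc w ∧
    (addSuc T w A T' ∨ addSuc T w B T')) ∨
  -- ⊃L
  (∃ w A B, w ∈ T.verts ∧ Fml.imp A B ∈ T.ant w ∧ A ∉ T.suc w ∧ B ∉ T.ant w ∧
    (addSuc T w A T' ∨ addAnt T w B T')) ∨
  -- ⟨x⟩L
  (∃ w u x A, w ∈ T.verts ∧ Fml.diaF x A ∈ T.ant w ∧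
    (¬ ∃ v, T.Reach ct cb x w v ∧ A ∈ T.ant v) ∧
    extendAt T w u x ({A}, ∅) T') ∨
  -- ⟨x⟩R
  (∃ w u x A, w ∈ T.verts ∧ Fml.diaF x A ∈ T.suc w ∧ T.Reach ct cb x w u ∧
    A ∉ T.suc u ∧ addSuc T u A T') ∨
  -- [x]L
  (∃ w u x A, w ∈ T.verts ∧ Fml.boxF x A ∈ T.ant w ∧ T.Reach ct cb x w u ∧
    A ∉ T.ant u ∧ addAnt T u A T') ∨
  -- d
  (cd = true ∧ ∃ w u k, T.AtDepth w k ∧ k ≤ m ∧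
    (¬ ∃ v, (w, v) ∈ T.edges ∧ T.elabel w v = true) ∧ extendAt T w u true (∅, ∅) T') ∨
  -- db (simultaneous ⊃R / [x]R applications on saturated sequents)
  (Saturated ct cb cd m T ∧
    ((∃ w A B, ImpRRule T w A B T') ∨ (∃ w u x A, BoxRRule T w u x A T')))

/-- `T` occurs in the computation tree `ct(I)` generated by `Prove_C(I)`:
it is obtainable from `I` by a sequence of proof-search steps. -/
def InCT (ct cb cd : Bool) (I T : SeqTree) : Prop :=
  Relation.ReflTransGen (AlgStep ct cb cd I.mdep) I T

/-! ## Computation trees -/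

/-- A node of a computation tree: a seq-tree, the Boolean value returned by the
corresponding recursive call of `Prove_C`, and the list of child nodes. -/
inductive RTree : Type where
  | node : SeqTree → Bool → List RTree → RTree

/-- The seq-tree at the root of a computation tree. -/
def RTree.seq : RTree → SeqTree
  | .node T _ _ => T

/-- The Boolean label at the root of a computation tree. -/
def RTree.val : RTree → Bool
  | .node _ b _ => b

/-- The children of the root of a computation tree. -/
def RTree.kids : RTree → List RTree
  | .node _ _ ts => ts

/-- Proof search is still running at `T` (none of the halting conditions of
lines 1–6 of `Prove_C` applies). -/
def Running (ct cb cd : Bool) (m : ℕ) (hist : List SeqTree) (T : SeqTree) : Prop :=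
  ¬ InitialSeq T ∧ ¬ StableSeq ct cb cd m T ∧ ¬ Repeats ct cb cd m hist T

/-- `ValidCT ct cb cd m hist t`: the labelled tree `t` is a computation tree
generated by a run of `Prove_C` (with ancestor list `hist`): each parent is the
conclusion of a rule of `(NIK_tC ∖ {⊃R, [x]R}) ∪ {db}` with its children the
premises, halting nodes are labelled as the algorithm prescribes, conjunctive
branching takes the conjunction of the children's values, and the disjunctive
branching rule `db` (applied to saturated sequents, with one premise for each
output implication and each output box) takes their disjunction. -/
inductive ValidCT (ct cb cd : Bool) (m : ℕ) : List SeqTree → RTree → Prop where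
  | initial {hist T} : InitialSeq T → ValidCT ct cb cd m hist (.node T true [])
  | stable {hist T} : ¬ InitialSeq T → StableSeq ct cb cd m T →
      ValidCT ct cb cd m hist (.node T false [])
  | rep {hist T} : ¬ InitialSeq T → Repeats ct cb cd m hist T →
      ValidCT ct cb cd m hist (.node T false [])
  | orL {hist T w A B t1 t2} : Running ct cb cd m hist T →
      w ∈ T.verts → Fml.or A B ∈ T.ant w → A ∉ T.ant w → B ∉ T.ant w →
      addAnt T w A t1.seq → addAnt T w B t2.seq →
      ValidCT ct cb cd m (T :: hist) t1 → ValidCT ct cb cd m (T :: hist) t2 →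
      ValidCT ct cb cd m hist (.node T (t1.val && t2.val) [t1, t2])
  | orR {hist T w A B t} : Running ct cb cd m hist T →
      w ∈ T.verts → Fml.or A B ∈ T.suc w → ¬ (A ∈ T.suc w ∧ B ∈ T.suc w) →
      updAt T w (T.ant w, insert A (insert B (T.suc w))) t.seq →
      ValidCT ct cb cd m (T :: hist) t →
      ValidCT ct cb cd m hist (.node T t.val [t])
  | andL {hist T w A B t} : Running ct cb cd m hist T →
      w ∈ T.verts → Fml.and A B ∈ T.ant w → ¬ (A ∈ T.ant w ∧ B ∈ T.ant w) →
      updAt T w (insert A (insert B (T.ant w)), T.suc w) t.seq →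
      ValidCT ct cb cd m (T :: hist) t →
      ValidCT ct cb cd m hist (.node T t.val [t])
  | andR {hist T w A B t1 t2} : Running ct cb cd m hist T →
      w ∈ T.verts → Fml.and A B ∈ T.suc w → A ∉ T.suc w → B ∉ T.suc w →
      addSuc T w A t1.seq → addSuc T w B t2.seq →
      ValidCT ct cb cd m (T :: hist) t1 → ValidCT ct cb cd m (T :: hist) t2 →
      ValidCT ct cb cd m hist (.node T (t1.val && t2.val) [t1, t2])
  | impL {hist T w A B t1 t2} : Running ct cb cd m hist T →
      w ∈ T.verts → Fml.imp A B ∈ T.ant w → A ∉ T.suc w → B ∉ T.ant w →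
      addSuc T w A t1.seq → addAnt T w B t2.seq →
      ValidCT ct cb cd m (T :: hist) t1 → ValidCT ct cb cd m (T :: hist) t2 →
      ValidCT ct cb cd m hist (.node T (t1.val && t2.val) [t1, t2])
  | diaL {hist T w u x A t} : Running ct cb cd m hist T →
      w ∈ T.verts → Fml.diaF x A ∈ T.ant w →
      (¬ ∃ v, T.Reach ct cb x w v ∧ A ∈ T.ant v) →
      extendAt T w u x ({A}, ∅) t.seq →
      ValidCT ct cb cd m (T :: hist) t →
      ValidCT ct cb cd m hist (.node T t.val [t])
  | diaR {hist T w u x A t} : Running ct cb cd m hist T →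
      w ∈ T.verts → Fml.diaF x A ∈ T.suc w → T.Reach ct cb x w u → A ∉ T.suc u →
      addSuc T u A t.seq →
      ValidCT ct cb cd m (T :: hist) t →
      ValidCT ct cb cd m hist (.node T t.val [t])
  | boxL {hist T w u x A t} : Running ct cb cd m hist T →
      w ∈ T.verts → Fml.boxF x A ∈ T.ant w → T.Reach ct cb x w u → A ∉ T.ant u →
      addAnt T u A t.seq →
      ValidCT ct cb cd m (T :: hist) t →
      ValidCT ct cb cd m hist (.node T t.val [t])
  | d {hist T w u k t} : Running ct cb cd m hist T →
      cd = true → T.AtDepth w k → k ≤ m →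
      (¬ ∃ v, (w, v) ∈ T.edges ∧ T.elabel w v = true) →
      extendAt T w u true (∅, ∅) t.seq →
      ValidCT ct cb cd m (T :: hist) t →
      ValidCT ct cb cd m hist (.node T t.val [t])
  | db {hist T ts} : Running ct cb cd m hist T →
      Saturated ct cb cd m T →
      (∀ t ∈ ts, ValidCT ct cb cd m (T :: hist) t) →
      (∀ t ∈ ts, (∃ w A B, ImpRRule T w A B t.seq) ∨ (∃ w u x A, BoxRRule T w u x A t.seq)) →
      (∀ w ∈ T.verts, ∀ A B, Fml.imp A B ∈ T.suc w → ∃ t ∈ ts, ImpRRule T w A B t.seq) →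
      (∀ w ∈ T.verts, ∀ x A, Fml.boxF x A ∈ T.suc w → ∃ t ∈ ts, ∃ u, BoxRRule T w u x A t.seq) →
      ValidCT ct cb cd m hist (.node T (ts.any RTree.val) ts)

/-! ## Blueprints and the extracted counter-model -/

/-- The subtree of a computation tree at the address `π` (a list of child
positions); addresses play the role of the positions of the enumeration `η`. -/
def RTree.at? : RTree → List ℕ → Option RTree
  | t, [] => some t
  | t, i :: π =>
    match t.kids[i]? with
    | some t' => t'.at? π
    | none => none

/-- The seq-tree at the address `π` of a computation tree. -/
def RTree.seqAt (t : RTree) (π : List ℕ) : SeqTree :=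
  (t.at? π).elim default RTree.seq

/-- The node at address `π` exists and every node on the path from the root to
it (inclusive) is labelled `F`; these are the nodes of the blueprint `bp(I)`. -/
def FNode (t : RTree) (π : List ℕ) : Prop :=
  ∀ σ, σ <+: π → ∃ s, t.at? σ = some s ∧ s.val = false

/-- Membership in the set `S` of the blueprint: an `F`-reachable node whose
seq-tree is `C`-saturated (an η-renamed saturated seq-tree of `bp(I)`;
the vertex `w` of the seq-tree at address `π` represents the renamed
component `(w, π)`). -/
def InSsat (ct cb cd : Bool) (m : ℕ) (t : RTree) (π : List ℕ) : Prop :=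
  FNode t π ∧ Saturated ct cb cd m (t.seqAt π)

/-- The node at address `π` is a repeat of the blueprint: an `F`-path leaf of
the computation tree that is saturated but not stable. -/
def RepNode (ct cb cd : Bool) (m : ℕ) (t : RTree) (π : List ℕ) : Prop :=
  FNode t π ∧ (∃ s, t.at? π = some s ∧ s.kids = []) ∧
  Saturated ct cb cd m (t.seqAt π) ∧ ¬ StableSeq ct cb cd m (t.seqAt π)

/-- `(gc, gf)` is a family `γ⃗` of strong morphisms mapping each repeat of the
blueprint to its companion: a proper ancestor belonging to `S` (C-saturated,
on an `F`-path) together with a strong morphism onto it. -/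
def GammaOK (ct cb cd : Bool) (m : ℕ) (t : RTree)
    (gc : List ℕ → List ℕ) (gf : List ℕ → ℕ → ℕ) : Prop :=
  ∀ π, RepNode ct cb cd m t π →
    gc π <+: π ∧ gc π ≠ π ∧ InSsat ct cb cd m t (gc π) ∧
    StrongMorphism (t.seqAt π) (t.seqAt (gc π)) (gf π)

/-- One step of a morphic sequence: either a natural morphism between members
of `S` related by `≺_bp*` (mapping `(w, π)` to `(w, π')`), or a strong morphism
of the family `γ⃗` mapping a repeat to its companion. -/
inductive MStep (ct cb cd : Bool) (m : ℕ) (t : RTree)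
    (gc : List ℕ → List ℕ) (gf : List ℕ → ℕ → ℕ) :
    (ℕ × List ℕ) → (ℕ × List ℕ) → Prop where
  | nat {w : ℕ} {π π' : List ℕ} :
      InSsat ct cb cd m t π → InSsat ct cb cd m t π' → π <+: π' →
      w ∈ (t.seqAt π).verts →
      MStep ct cb cd m t gc gf (w, π) (w, π')
  | rep {w : ℕ} {π : List ℕ} :
      RepNode ct cb cd m t π → w ∈ (t.seqAt π).verts →
      MStep ct cb cd m t gc gf (w, π) (gf π w, gc π)

/-- A morphic sequence `(w, π) ⟶_σ (u, π')` in the blueprint. -/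
def MSeq (ct cb cd : Bool) (m : ℕ) (t : RTree)
    (gc : List ℕ → List ℕ) (gf : List ℕ → ℕ → ℕ) :
    (ℕ × List ℕ) → (ℕ × List ℕ) → Prop :=
  Relation.ReflTransGen (MStep ct cb cd m t gc gf)

/-- The set `W` of worlds of the extracted model: the (renamed) components of
the saturated seq-trees of the blueprint. -/
def Worlds (ct cb cd : Bool) (m : ℕ) (t : RTree) : Set (ℕ × List ℕ) :=
  {a | InSsat ct cb cd m t a.2 ∧ a.1 ∈ (t.seqAt a.2).verts}

/-- The modal relation `R` of the extracted model: induced by the C-closure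
reachability relation inside each saturated seq-tree, together with self-loops
at components of depth `m + 1` when `D ∈ C`. -/
def bpR (ct cb cd : Bool) (m : ℕ) (t : RTree) :
    (ℕ × List ℕ) → (ℕ × List ℕ) → Prop :=
  fun a b =>
    (a.2 = b.2 ∧ InSsat ct cb cd m t a.2 ∧ (t.seqAt a.2).Reach ct cb true a.1 b.1) ∨
    (cd = true ∧ a = b ∧ InSsat ct cb cd m t a.2 ∧ (t.seqAt a.2).AtDepth a.1 (m + 1))

/-- The valuation `V` of the extracted model: `(w, π) ∈ V(p)` iff `p` occurs in
the antecedent of the component `(w, π)`. -/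
def bpVal (ct cb cd : Bool) (m : ℕ) (t : RTree) : (ℕ × List ℕ) → ℕ → Prop :=
  fun a p => InSsat ct cb cd m t a.2 ∧ Fml.atom p ∈ (t.seqAt a.2).ant a.1

/-- Satisfaction over raw frame data (the same clauses as `Model.Sat`). -/
def SatR {W : Type} (le R : W → W → Prop) (val : W → ℕ → Prop) : W → Fml → Prop
  | w, .atom p => val w p
  | _, .bot => False
  | w, .or A B => SatR le R val w A ∨ SatR le R val w B
  | w, .and A B => SatR le R val w A ∧ SatR le R val w B
  | w, .imp A B => ∀ u, le w u → SatR le R val u A → SatR le R val u B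
  | w, .dia A => ∃ u, R w u ∧ SatR le R val u A
  | w, .bdia A => ∃ u, R u w ∧ SatR le R val u A
  | w, .box A => ∀ u v, le w u → R u v → SatR le R val v A
  | w, .bbox A => ∀ u v, le w u → R v u → SatR le R val v A

namespace Fml

theorem self_mem_subf (A : Fml) : A ∈ A.subf := by
  cases A <;> simp [subf]

theorem subf_subset {A B : Fml} (h : A ∈ B.subf) : A.subf ⊆ B.subf := by
  induction B with
  | atom p => simp only [subf, Finset.mem_singleton] at h; rw [h]
  | bot => simp only [subf, Finset.mem_singleton] at h; rw [h]
  | or C D hC hD | and C D hC hD | imp C D hC hD =>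
    simp only [subf, Finset.mem_insert, Finset.mem_union] at h
    rcases h with rfl | h | h
    · rfl
    · exact (hC h).trans (Finset.subset_union_left.trans (Finset.subset_insert _ _))
    · exact (hD h).trans (Finset.subset_union_right.trans (Finset.subset_insert _ _))
  | dia C hC | bdia C hC | box C hC | bbox C hC =>
    simp only [subf, Finset.mem_insert] at h
    rcases h with rfl | h
    · rfl
    · exact (hC h).trans (Finset.subset_insert _ _)

end Fml

/-- A set of formulae is closed under subformulae. -/
def SubfClosed (S : Finset Fml) : Prop := ∀ A ∈ S, A.subf ⊆ S

/-- `A` belongs to `S` and has room for its modal depth at depth `k`, with total budget `M`. -/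
def FitsAt (S : Finset Fml) (M k : ℕ) (A : Fml) : Prop := A ∈ S ∧ A.mdep + k ≤ M

theorem FitsAt.of_subf {S : Finset Fml} {M k l : ℕ} {A B : Fml} (hS : SubfClosed S)
    (h : FitsAt S M k A) (hB : B ∈ A.subf) (hd : B.mdep + l ≤ A.mdep + k) : FitsAt S M l B :=
  ⟨hS A h.1 hB, hd.trans h.2⟩

theorem FitsAt.left {S : Finset Fml} {M k : ℕ} {A B C : Fml} (hS : SubfClosed S)
    (h : FitsAt S M k C) (hC : C = A.or B ∨ C = A.and B ∨ C = A.imp B) : FitsAt S M k A := by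
  rcases hC with rfl | rfl | rfl <;>
    exact h.of_subf hS (by simp [Fml.subf, Fml.self_mem_subf]) (by simp [Fml.mdep])

theorem FitsAt.right {S : Finset Fml} {M k : ℕ} {A B C : Fml} (hS : SubfClosed S)
    (h : FitsAt S M k C) (hC : C = A.or B ∨ C = A.and B ∨ C = A.imp B) : FitsAt S M k B := by
  rcases hC with rfl | rfl | rfl <;>
    exact h.of_subf hS (by simp [Fml.subf, Fml.self_mem_subf]) (by simp [Fml.mdep])

theorem FitsAt.modal {S : Finset Fml} {M k l : ℕ} {x : Bool} {A C : Fml} (hS : SubfClosed S)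
    (h : FitsAt S M k C) (hC : C = Fml.diaF x A ∨ C = Fml.boxF x A) (hl : l ≤ k + 1) :
    FitsAt S M l A := by
  rcases hC with rfl | rfl <;> cases x <;>
    exact h.of_subf hS (by simp [Fml.diaF, Fml.boxF, Fml.subf, Fml.self_mem_subf])
      (by simp only [Fml.diaF, Fml.boxF, Fml.mdep]; omega)

theorem SeqTree.subfClosed_subfs (T : SeqTree) : SubfClosed T.subfs := by
  intro A hA B hB
  simp only [subfs, Finset.mem_biUnion] at hA ⊢
  obtain ⟨C, hC, hAC⟩ := hA
  exact ⟨C, hC, Fml.subf_subset hAC hB⟩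

namespace SeqTree

theorem AtDepth.mem {T : SeqTree} {w k : ℕ} (h : T.AtDepth w k) : w ∈ T.verts := by
  cases h with
  | root => exact T.root_mem
  | step _ he => exact (T.edges_sub _ he).2

theorem AtDepth.unique {T : SeqTree} {w k l : ℕ} (h : T.AtDepth w k) (h' : T.AtDepth w l) :
    k = l := by
  induction h generalizing l with
  | root =>
    cases h' with
    | root => rfl
    | step _ he => exact absurd he (T.root_no_parent _)
  | step _ he ih =>
    cases h' with
    | root => exact absurd he (T.root_no_parent _)
    | step hu he' =>
      obtain rfl := T.parent_unique _ (T.edges_sub _ he).2 _ _ he he'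
      rw [ih hu]

theorem exists_atDepth {T : SeqTree} {w : ℕ} (hw : w ∈ T.verts) : ∃ k, T.AtDepth w k := by
  induction T.connected w hw with
  | refl => exact ⟨0, .root⟩
  | tail _ he ih =>
    obtain ⟨k, hk⟩ := ih (T.edges_sub _ he).1
    exact ⟨k + 1, hk.step he⟩

/-- The depth of a component. -/
noncomputable def dep (T : SeqTree) (w : ℕ) : ℕ := sInf {k | T.AtDepth w k}

theorem atDepth_dep {T : SeqTree} {w : ℕ} (hw : w ∈ T.verts) : T.AtDepth w (T.dep w) :=
  Nat.sInf_mem (exists_atDepth hw)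

theorem AtDepth.dep_eq {T : SeqTree} {w k : ℕ} (h : T.AtDepth w k) : T.dep w = k :=
  (atDepth_dep h.mem).unique h

theorem dep_of_edge {T : SeqTree} {u v : ℕ} (h : (u, v) ∈ T.edges) : T.dep v = T.dep u + 1 :=
  ((atDepth_dep (T.edges_sub _ h).1).step h).dep_eq

theorem Reach.dep_le {T : SeqTree} {ct cb x : Bool} {w u : ℕ} (h : T.Reach ct cb x w u) :
    T.dep u ≤ T.dep w + 1 := by
  rcases h with ⟨h, -⟩ | ⟨h, -⟩ | ⟨-, rfl, -⟩ | ⟨-, ⟨h, -⟩ | ⟨h, -⟩⟩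
  all_goals first | (have := dep_of_edge h; omega) | omega

/-- `T'` extends `T`: it contains `T` as a subtree with the same root, with possibly larger
antecedents. -/
structure Extends (T T' : SeqTree) : Prop where
  verts : T.verts ⊆ T'.verts
  root : T'.root = T.root
  edges : T.edges ⊆ T'.edges
  elabel : ∀ u v, (u, v) ∈ T.edges → T'.elabel u v = T.elabel u v
  ant : ∀ w ∈ T.verts, T.ant w ⊆ T'.ant w

theorem Extends.atDepth {T T' : SeqTree} (h : T.Extends T') {w k : ℕ} (hw : T.AtDepth w k) :
    T'.AtDepth w k := by
  induction hw with
  | root => rw [← h.root]; exact .root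
  | step _ he ih => exact ih.step (h.edges he)

theorem Extends.dep_eq {T T' : SeqTree} (h : T.Extends T') {w : ℕ} (hw : w ∈ T.verts) :
    T'.dep w = T.dep w :=
  (h.atDepth (atDepth_dep hw)).dep_eq

theorem Extends.reach {T T' : SeqTree} (h : T.Extends T') {ct cb x : Bool} {w u : ℕ}
    (hr : T.Reach ct cb x w u) : T'.Reach ct cb x w u := by
  rcases hr with ⟨he, hl⟩ | ⟨he, hl⟩ | ⟨hc, rfl, hw⟩ | ⟨hc, ⟨he, hl⟩ | ⟨he, hl⟩⟩
  · exact .inl ⟨h.edges he, (h.elabel _ _ he).trans hl⟩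
  · exact .inr (.inl ⟨h.edges he, (h.elabel _ _ he).trans hl⟩)
  · exact .inr (.inr (.inl ⟨hc, rfl, h.verts hw⟩))
  · exact .inr (.inr (.inr ⟨hc, .inl ⟨h.edges he, (h.elabel _ _ he).trans hl⟩⟩))
  · exact .inr (.inr (.inr ⟨hc, .inr ⟨h.edges he, (h.elabel _ _ he).trans hl⟩⟩))

theorem Reach.right_mem {T : SeqTree} {ct cb x : Bool} {w u : ℕ} (h : T.Reach ct cb x w u) :
    u ∈ T.verts := by
  rcases h with ⟨h, -⟩ | ⟨h, -⟩ | ⟨-, rfl, h⟩ | ⟨-, ⟨h, -⟩ | ⟨h, -⟩⟩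
  all_goals first | exact h | exact (T.edges_sub _ h).1 | exact (T.edges_sub _ h).2

end SeqTree

/-! ### Finitely many seq-trees up to strong morphisms -/

/-- Codes of subtrees of height at most `n` with labels built from `S`. -/
def Code (S : Finset Fml) : ℕ → Type
  | 0 => Set S × Set S
  | n + 1 => (Set S × Set S) × Set (Bool × Code S n)

instance Code.instFinite (S : Finset Fml) : ∀ n, Finite (Code S n)
  | 0 => inferInstanceAs (Finite (Set S × Set S))
  | n + 1 =>
    have := Code.instFinite S n
    inferInstanceAs (Finite ((Set S × Set S) × Set (Bool × Code S n)))

namespace SeqTree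

/-- The part of a vertex label lying in `S`. -/
def labCode (S : Finset Fml) (T : SeqTree) (w : ℕ) : Set S × Set S :=
  ({A | A.1 ∈ T.ant w}, {A | A.1 ∈ T.suc w})

/-- The code of the subtree at `w`, truncated at height `n`. -/
def code (S : Finset Fml) (T : SeqTree) : (n : ℕ) → ℕ → Code S n
  | 0, w => T.labCode S w
  | n + 1, w =>
    (T.labCode S w, {p | ∃ v, (w, v) ∈ T.edges ∧ T.elabel w v = p.1 ∧ T.code S n v = p.2})

theorem labCode_eq_of_code_eq {S : Finset Fml} {T T' : SeqTree} {n w w' : ℕ}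
    (h : T.code S n w = T'.code S n w') : T.labCode S w = T'.labCode S w' := by
  cases n with
  | zero => exact h
  | succ n => exact congrArg Prod.fst h

theorem exists_child_of_code_eq {S : Finset Fml} {T T' : SeqTree} {n w w' v : ℕ}
    (h : T.code S (n + 1) w = T'.code S (n + 1) w') (hv : (w, v) ∈ T.edges) :
    ∃ v', (w', v') ∈ T'.edges ∧ T.elabel w v = T'.elabel w' v' ∧
      T.code S n v = T'.code S n v' := by
  have h2 : {p : Bool × Code S n | ∃ v, (w, v) ∈ T.edges ∧ T.elabel w v = p.1 ∧ T.code S n v = p.2} =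
      {p | ∃ v, (w', v) ∈ T'.edges ∧ T'.elabel w' v = p.1 ∧ T'.code S n v = p.2} :=
    congrArg Prod.snd h
  have h3 : (T.elabel w v, T.code S n v) ∈
      {p : Bool × Code S n | ∃ v, (w, v) ∈ T.edges ∧ T.elabel w v = p.1 ∧ T.code S n v = p.2} :=
    ⟨v, hv, rfl, rfl⟩
  rw [h2] at h3
  obtain ⟨v', h4, h5, h6⟩ := h3
  exact ⟨v', h4, h5.symm, h6.symm⟩

theorem vlab_eq_of_labCode_eq {S : Finset Fml} {T T' : SeqTree} {w w' : ℕ}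
    (hT : T.ant w ∪ T.suc w ⊆ S) (hT' : T'.ant w' ∪ T'.suc w' ⊆ S)
    (h : T.labCode S w = T'.labCode S w') : T.vlab w = T'.vlab w' := by
  have h1 := congrArg Prod.fst h
  have h2 := congrArg Prod.snd h
  simp only [labCode, Set.ext_iff, Set.mem_ofPred_eq, Subtype.forall] at h1 h2
  refine Prod.ext (Finset.ext fun A => ?_) (Finset.ext fun A => ?_)
  · exact ⟨fun hA => (h1 A (hT (Finset.mem_union_left _ hA))).1 hA,
      fun hA => (h1 A (hT' (Finset.mem_union_left _ hA))).2 hA⟩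
  · exact ⟨fun hA => (h2 A (hT (Finset.mem_union_right _ hA))).1 hA,
      fun hA => (h2 A (hT' (Finset.mem_union_right _ hA))).2 hA⟩

theorem exists_partial_morphism {S : Finset Fml} {T T' : SeqTree} {n : ℕ}
    (h : T.code S n T.root = T'.code S n T'.root) (j : ℕ) (hj : j ≤ n) :
    ∃ f : ℕ → ℕ, f T.root = T'.root ∧
      (∀ v k, T.AtDepth v k → k ≤ j →
        f v ∈ T'.verts ∧ T.code S (n - k) v = T'.code S (n - k) (f v)) ∧
      ∀ u v k, T.AtDepth u k → k < j → (u, v) ∈ T.edges →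
        (f u, f v) ∈ T'.edges ∧ T.elabel u v = T'.elabel (f u) (f v) := by
  induction j with
  | zero =>
    refine ⟨fun _ => T'.root, rfl, fun v k hv hk => ?_, fun u v k _ hk => absurd hk (by omega)⟩
    obtain rfl : k = 0 := by omega
    cases hv
    exact ⟨T'.root_mem, h⟩
  | succ j ih =>
    obtain ⟨f, hroot, hcode, hedge⟩ := ih (by omega)
    have key : ∀ v, ∃ v', (∀ u, T.AtDepth u j → (u, v) ∈ T.edges → (f u, v') ∈ T'.edges ∧
        T.elabel u v = T'.elabel (f u) v' ∧
        T.code S (n - (j + 1)) v = T'.code S (n - (j + 1)) v') ∧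
        ((¬ ∃ u, T.AtDepth u j ∧ (u, v) ∈ T.edges) → v' = f v) := by
      intro v
      by_cases hv : ∃ u, T.AtDepth u j ∧ (u, v) ∈ T.edges
      · obtain ⟨u, hu, huv⟩ := hv
        have hc := (hcode u j hu le_rfl).2
        rw [show n - j = n - (j + 1) + 1 by omega] at hc
        obtain ⟨v', h1, h2, h3⟩ := exists_child_of_code_eq hc huv
        refine ⟨v', fun u' _ hu'v => ?_, fun hn => absurd ⟨u, hu, huv⟩ hn⟩
        obtain rfl := T.parent_unique v (T.edges_sub _ huv).2 _ _ huv hu'v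
        exact ⟨h1, h2, h3⟩
      · exact ⟨f v, fun u hu huv => absurd ⟨u, hu, huv⟩ hv, fun _ => rfl⟩
    choose f' hnew hold using key
    have hsame : ∀ v k, T.AtDepth v k → k ≤ j → f' v = f v := by
      intro v k hv hk
      refine hold v ?_
      rintro ⟨u, hu, huv⟩
      have := hv.unique (hu.step huv)
      omega
    refine ⟨f', (hsame _ 0 .root (Nat.zero_le _)).trans hroot, fun v k hv hk => ?_,
      fun u v k hu hk huv => ?_⟩
    · rcases Nat.lt_or_ge j k with hjk | hjk
      · obtain rfl : k = j + 1 := by omega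
        cases hv with
        | step hu huv =>
          obtain ⟨h1, -, h3⟩ := hnew v _ hu huv
          exact ⟨(T'.edges_sub _ h1).2, h3⟩
      · rw [hsame v k hv hjk]
        exact hcode v k hv hjk
    · rw [hsame u k hu (by omega)]
      rcases Nat.lt_or_ge k j with hkj | hkj
      · rw [hsame v (k + 1) (hu.step huv) hkj]
        exact hedge u v k hu hkj huv
      · obtain rfl : k = j := by omega
        obtain ⟨h1, h2, -⟩ := hnew v u hu huv
        exact ⟨h1, h2⟩

theorem exists_strongMorphism_of_code_eq {S : Finset Fml} {T T' : SeqTree} {n : ℕ}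
    (hT : ∀ w ∈ T.verts, T.ant w ∪ T.suc w ⊆ S) (hT' : ∀ w ∈ T'.verts, T'.ant w ∪ T'.suc w ⊆ S)
    (hd : ∀ w ∈ T.verts, T.dep w ≤ n)
    (h : T.code S n T.root = T'.code S n T'.root) : ∃ f, StrongMorphism T T' f := by
  obtain ⟨f, hroot, hcode, hedge⟩ := exists_partial_morphism h n le_rfl
  have hc := fun v hv => hcode v _ (atDepth_dep hv) (hd v hv)
  refine ⟨f, ⟨fun v hv => (hc v hv).1, hroot, fun u v huv => ?_⟩, fun v hv => ?_⟩
  · have hu := (T.edges_sub _ huv).1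
    have hv := hd v (T.edges_sub _ huv).2
    rw [dep_of_edge huv] at hv
    exact hedge u v _ (atDepth_dep hu) hv huv
  · exact vlab_eq_of_labCode_eq (hT v hv) (hT' _ (hc v hv).1) (labCode_eq_of_code_eq (hc v hv).2)

end SeqTree

/-! ### The invariant of proof search -/

/-- All formulae belong to `S` and their modal depth plus the depth of their component is at
most `M`; all components have depth at most `M + 1`. -/
structure Bounded (S : Finset Fml) (M : ℕ) (T : SeqTree) : Prop where
  fits : ∀ w ∈ T.verts, ∀ A, A ∈ T.ant w ∨ A ∈ T.suc w → FitsAt S M (T.dep w) A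
  dep_le : ∀ w ∈ T.verts, T.dep w ≤ M + 1

theorem Bounded.subset {S : Finset Fml} {M : ℕ} {T : SeqTree} (h : Bounded S M T) {w : ℕ}
    (hw : w ∈ T.verts) : T.ant w ∪ T.suc w ⊆ S := fun A hA =>
  (h.fits w hw A (Finset.mem_union.1 hA)).1

theorem SeqTree.exists_bounded (T : SeqTree) (m : ℕ) : ∃ M, m ≤ M ∧ Bounded T.subfs M T := by
  classical
  refine ⟨m + ∑ w ∈ T.verts, (T.dep w + ∑ A ∈ T.ant w ∪ T.suc w, A.mdep), by omega, ?_, ?_⟩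
  · intro w hw A hA
    refine ⟨?_, ?_⟩
    · simp only [subfs, Finset.mem_biUnion, Finset.mem_union]
      exact ⟨A, ⟨w, hw, hA⟩, A.self_mem_subf⟩
    · have h1 := Finset.single_le_sum (f := Fml.mdep) (fun _ _ => Nat.zero_le _)
        (Finset.mem_union.2 hA)
      have h2 := Finset.single_le_sum
        (f := fun w => T.dep w + ∑ A ∈ T.ant w ∪ T.suc w, A.mdep) (fun _ _ => Nat.zero_le _) hw
      omega
  · intro w hw
    have h2 := Finset.single_le_sum
        (f := fun w => T.dep w + ∑ A ∈ T.ant w ∪ T.suc w, A.mdep) (fun _ _ => Nat.zero_le _) hw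
    omega

theorem Bounded.of_extends {S : Finset Fml} {M : ℕ} {T T' : SeqTree} (h : Bounded S M T)
    (he : T.Extends T')
    (hold : ∀ w ∈ T.verts, ∀ A, A ∈ T'.ant w ∨ A ∈ T'.suc w →
      (A ∈ T.ant w ∨ A ∈ T.suc w) ∨ FitsAt S M (T.dep w) A)
    (hnew : ∀ w ∈ T'.verts, w ∉ T.verts → T'.dep w ≤ M + 1 ∧
      ∀ A, A ∈ T'.ant w ∨ A ∈ T'.suc w → FitsAt S M (T'.dep w) A) : Bounded S M T' := by
  refine ⟨fun w hw A hA => ?_, fun w hw => ?_⟩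
  · by_cases hwT : w ∈ T.verts
    · rw [he.dep_eq hwT]
      exact (hold w hwT A hA).elim (h.fits w hwT A) id
    · exact (hnew w hw hwT).2 A hA
  · by_cases hwT : w ∈ T.verts
    · rw [he.dep_eq hwT]
      exact h.dep_le w hwT
    · exact (hnew w hw hwT).1

/-! ### The termination measure -/

section Measure

variable (ct cb : Bool) (S : Finset Fml) (M K : ℕ)

open Classical in
/-- The number of ways in which `⟨x⟩L` and `d` may still be applied at `w`. -/
noncomputable def SeqTree.pending (T : SeqTree) (w : ℕ) : ℕ :=
  (((Finset.univ : Finset Bool) ×ˢ S).filter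
    fun p => ¬ ∃ v, T.Reach ct cb p.1 w v ∧ p.2 ∈ T.ant v).card +
  if ∃ v, (w, v) ∈ T.edges ∧ T.elabel w v = true then 0 else 1

/-- The base of the weights of the components. -/
def measureBase : ℕ := (2 * S.card + 1) + (2 * S.card + K * S.card + 1)

/-- The contribution of a component to the termination measure, where `b` is the number of
applications of `db` still available. -/
noncomputable def SeqTree.vertexMeasure (b : ℕ) (T : SeqTree) (w : ℕ) : ℕ :=
  measureBase S K ^ (M + 1 - T.dep w) * T.pending ct cb S w +
    (S \ T.ant w).card + (S \ T.suc w).card + b * S.card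

/-- The termination measure, where `b` is the number of applications of `db` still available. -/
noncomputable def SeqTree.searchMeasure (b : ℕ) (T : SeqTree) : ℕ :=
  ∑ w ∈ T.verts, T.vertexMeasure ct cb S M K b w + b * measureBase S K ^ (M + 2)

variable {ct cb S M K}

theorem SeqTree.pending_le (T : SeqTree) (w : ℕ) : T.pending ct cb S w ≤ 2 * S.card + 1 := by
  classical
  unfold pending
  refine add_le_add ((Finset.card_filter_le _ _).trans (by simp)) ?_
  split_ifs <;> simp

theorem measureBase_pos : 0 < measureBase S K := by
  unfold measureBase; omega

theorem SeqTree.vertexMeasure_lt {b j : ℕ} (hb : b ≤ K) (T : SeqTree) (w : ℕ)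
    (hj : M + 1 - T.dep w ≤ j) :
    T.vertexMeasure ct cb S M K b w < measureBase S K ^ (j + 1) := by
  unfold vertexMeasure
  have h1 : measureBase S K ^ (M + 1 - T.dep w) * T.pending ct cb S w ≤
      measureBase S K ^ j * (2 * S.card + 1) :=
    Nat.mul_le_mul (Nat.pow_le_pow_right measureBase_pos hj) (T.pending_le w)
  have h2 := Finset.card_le_card (Finset.sdiff_subset (s := S) (t := T.ant w))
  have h3 := Finset.card_le_card (Finset.sdiff_subset (s := S) (t := T.suc w))
  have h4 : b * S.card ≤ K * S.card := Nat.mul_le_mul_right _ hb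
  have h5 : 2 * S.card + K * S.card + 1 ≤
      measureBase S K ^ j * (2 * S.card + K * S.card + 1) :=
    Nat.le_mul_of_pos_left _ (pow_pos measureBase_pos j)
  have h6 : measureBase S K ^ (j + 1) = measureBase S K ^ j * (2 * S.card + 1) +
      measureBase S K ^ j * (2 * S.card + K * S.card + 1) := by
    rw [pow_succ, ← mul_add]; rfl
  omega

theorem SeqTree.Extends.pending_le {T T' : SeqTree} (h : T.Extends T') (w : ℕ) :
    T'.pending ct cb S w ≤ T.pending ct cb S w := by
  classical
  unfold pending
  refine add_le_add (Finset.card_le_card (Finset.monotone_filter_right _ ?_)) ?_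
  · rintro p - hp ⟨v, hv, hA⟩
    exact hp ⟨v, h.reach hv, h.ant v hv.right_mem hA⟩
  · by_cases hv : ∃ v, (w, v) ∈ T.edges ∧ T.elabel w v = true
    · have hv' : ∃ v, (w, v) ∈ T'.edges ∧ T'.elabel w v = true := by
        obtain ⟨v, he, hl⟩ := hv
        exact ⟨v, h.edges he, (h.elabel _ _ he).trans hl⟩
      simp [hv']
    · rw [if_neg hv]
      split_ifs <;> simp

theorem SeqTree.Extends.pending_lt_of_reach {T T' : SeqTree} (h : T.Extends T') {w u : ℕ}
    {x : Bool} {A : Fml} (hA : A ∈ S) (hT : ¬ ∃ v, T.Reach ct cb x w v ∧ A ∈ T.ant v)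
    (hT' : T'.Reach ct cb x w u) (hu : A ∈ T'.ant u) :
    T'.pending ct cb S w < T.pending ct cb S w := by
  classical
  unfold pending
  refine add_lt_add_of_lt_of_le (Finset.card_lt_card ?_) ?_
  · rw [Finset.ssubset_iff_of_subset (Finset.monotone_filter_right _ ?_)]
    · refine ⟨(x, A), by simpa [hA] using hT, ?_⟩
      simp only [Finset.mem_filter, not_and, not_not]
      exact fun _ => ⟨u, hT', hu⟩
    · rintro p - hp ⟨v, hv, hA⟩
      exact hp ⟨v, h.reach hv, h.ant v hv.right_mem hA⟩
  · have h0 := h.pending_le (ct := ct) (cb := cb) (S := ∅) w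
    simpa [pending] using h0

theorem SeqTree.Extends.pending_lt_of_edge {T T' : SeqTree} (h : T.Extends T') {w u : ℕ}
    (hT : ¬ ∃ v, (w, v) ∈ T.edges ∧ T.elabel w v = true)
    (hT' : (w, u) ∈ T'.edges ∧ T'.elabel w u = true) :
    T'.pending ct cb S w < T.pending ct cb S w := by
  classical
  unfold pending
  refine add_lt_add_of_le_of_lt (Finset.card_le_card (Finset.monotone_filter_right _ ?_)) ?_
  · rintro p - hp ⟨v, hv, hA⟩
    exact hp ⟨v, h.reach hv, h.ant v hv.right_mem hA⟩
  · rw [if_neg hT, if_pos ⟨u, hT'⟩]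
    exact Nat.zero_lt_one

theorem SeqTree.Extends.vertexMeasure_le {T T' : SeqTree} (h : T.Extends T') {b w : ℕ}
    (hw : w ∈ T.verts) (hs : T.suc w ⊆ T'.suc w) :
    T'.vertexMeasure ct cb S M K b w ≤ T.vertexMeasure ct cb S M K b w := by
  unfold vertexMeasure
  rw [h.dep_eq hw]
  have h1 := Nat.mul_le_mul_left (measureBase S K ^ (M + 1 - T.dep w))
    (h.pending_le (ct := ct) (cb := cb) (S := S) w)
  have h2 := Finset.card_le_card (Finset.sdiff_subset_sdiff subset_rfl (h.ant w hw) : S \ _ ⊆ _)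
  have h3 := Finset.card_le_card (Finset.sdiff_subset_sdiff subset_rfl hs : S \ _ ⊆ _)
  omega

theorem SeqTree.Extends.vertexMeasure_le_succ {T T' : SeqTree} (h : T.Extends T') {b w : ℕ}
    (hw : w ∈ T.verts) :
    T'.vertexMeasure ct cb S M K b w ≤ T.vertexMeasure ct cb S M K (b + 1) w := by
  unfold vertexMeasure
  rw [h.dep_eq hw, Nat.succ_mul]
  have h1 := Nat.mul_le_mul_left (measureBase S K ^ (M + 1 - T.dep w))
    (h.pending_le (ct := ct) (cb := cb) (S := S) w)
  have h2 := Finset.card_le_card (Finset.sdiff_subset_sdiff subset_rfl (h.ant w hw) : S \ _ ⊆ _)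
  have h3 := Finset.card_le_card (Finset.sdiff_subset (s := S) (t := T'.suc w))
  omega

theorem Finset.card_sdiff_lt_of_ssubset {α : Type*} [DecidableEq α] {s t u : Finset α}
    (hst : s ⊂ t) (ht : t ⊆ u) : (u \ t).card < (u \ s).card := by
  refine Finset.card_lt_card (Finset.ssubset_iff_of_subset
    (Finset.sdiff_subset_sdiff subset_rfl hst.1) |>.2 ?_)
  obtain ⟨a, hat, has⟩ := Finset.exists_of_ssubset hst
  exact ⟨a, Finset.mem_sdiff.2 ⟨ht hat, has⟩, fun h => (Finset.mem_sdiff.1 h).2 hat⟩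

/-- Enlarging the label of a component preserves the invariant and decreases the measure. -/
theorem updAt_bounded_and_lt {T T' : SeqTree} {w b : ℕ} {s : GSeq} (hT : Bounded S M T)
    (hw : w ∈ T.verts) (hu : updAt T w s T') (h1 : T.ant w ⊆ s.1) (h2 : T.suc w ⊆ s.2)
    (hne : s ≠ T.vlab w)
    (hs : ∀ A, A ∈ s.1 ∨ A ∈ s.2 → (A ∈ T.ant w ∨ A ∈ T.suc w) ∨ FitsAt S M (T.dep w) A) :
    Bounded S M T' ∧ T'.searchMeasure ct cb S M K b < T.searchMeasure ct cb S M K b := by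
  obtain ⟨⟨hverts, hroot, hedges, hlab⟩, hvlab⟩ := hu
  have hantw : T'.ant w = s.1 := by simp [SeqTree.ant, hvlab]
  have hsucw : T'.suc w = s.2 := by simp [SeqTree.suc, hvlab]
  have hant : ∀ v, v ≠ w → T'.ant v = T.ant v := fun v hv => by simp [SeqTree.ant, hvlab, hv]
  have hsuc : ∀ v, v ≠ w → T'.suc v = T.suc v := fun v hv => by simp [SeqTree.suc, hvlab, hv]
  have he : T.Extends T' := by
    refine ⟨hverts.ge, hroot, hedges.ge, fun _ _ _ => by rw [hlab], fun v _ => ?_⟩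
    by_cases hv : v = w
    · subst hv; rwa [hantw]
    · rw [hant v hv]
  have hb : Bounded S M T' := by
    refine hT.of_extends he (fun v _ A hA => ?_) fun v hv hv' => absurd (hverts ▸ hv) hv'
    by_cases hvw : v = w
    · subst hvw
      rw [hantw, hsucw] at hA
      exact hs A hA
    · rw [hant v hvw, hsuc v hvw] at hA
      exact .inl hA
  have hsucsub : ∀ v, T.suc v ⊆ T'.suc v := fun v => by
    by_cases hv : v = w
    · subst hv; rwa [hsucw]
    · rw [hsuc v hv]
  refine ⟨hb, ?_⟩
  unfold SeqTree.searchMeasure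
  rw [hverts]
  refine Nat.add_lt_add_right (Finset.sum_lt_sum (fun v hv => he.vertexMeasure_le hv (hsucsub v))
    ⟨w, hw, ?_⟩) _
  have hS := hb.subset (hverts ▸ hw)
  have hSa := Finset.union_subset_left hS
  have hSs := Finset.union_subset_right hS
  unfold SeqTree.vertexMeasure
  rw [he.dep_eq hw]
  have h3 := Nat.mul_le_mul_left (measureBase S K ^ (M + 1 - T.dep w))
    (he.pending_le (ct := ct) (cb := cb) (S := S) w)
  have h4 := Finset.card_le_card
    (Finset.sdiff_subset_sdiff subset_rfl (he.ant w hw) : S \ _ ⊆ _)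
  have h5 := Finset.card_le_card
    (Finset.sdiff_subset_sdiff subset_rfl (hsucsub w) : S \ _ ⊆ _)
  by_cases ha : s.1 = T.ant w
  · have hs' : T.suc w ≠ T'.suc w := by
      rw [hsucw]
      exact fun h => hne (Prod.ext ha h.symm)
    have := Finset.card_sdiff_lt_of_ssubset ((hsucsub w).ssubset_of_ne hs') hSs
    omega
  · have ha' : T.ant w ≠ T'.ant w := by
      rw [hantw]
      exact Ne.symm ha
    have := Finset.card_sdiff_lt_of_ssubset ((he.ant w hw).ssubset_of_ne ha') hSa
    omega

theorem addAnt_bounded_and_lt {T T' : SeqTree} {w b : ℕ} {A : Fml} (hT : Bounded S M T)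
    (h : addAnt T w A T') (hA : A ∉ T.ant w) (hs : FitsAt S M (T.dep w) A) :
    Bounded S M T' ∧ T'.searchMeasure ct cb S M K b < T.searchMeasure ct cb S M K b := by
  refine updAt_bounded_and_lt hT h.1 h.2 (Finset.subset_insert _ _) subset_rfl (fun he => hA ?_) ?_
  · have h1 : insert A (T.ant w) = T.ant w := congrArg Prod.fst he
    exact h1 ▸ Finset.mem_insert_self A _
  · rintro B (hB | hB)
    · rcases Finset.mem_insert.1 hB with rfl | hB
      · exact .inr hs
      · exact .inl (.inl hB)
    · exact .inl (.inr hB)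

theorem addSuc_bounded_and_lt {T T' : SeqTree} {w b : ℕ} {A : Fml} (hT : Bounded S M T)
    (h : addSuc T w A T') (hA : A ∉ T.suc w) (hs : FitsAt S M (T.dep w) A) :
    Bounded S M T' ∧ T'.searchMeasure ct cb S M K b < T.searchMeasure ct cb S M K b := by
  refine updAt_bounded_and_lt hT h.1 h.2 subset_rfl (Finset.subset_insert _ _) (fun he => hA ?_) ?_
  · have h1 : insert A (T.suc w) = T.suc w := congrArg Prod.snd he
    exact h1 ▸ Finset.mem_insert_self A _
  · rintro B (hB | hB)
    · exact .inl (.inl hB)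
    · rcases Finset.mem_insert.1 hB with rfl | hB
      · exact .inr hs
      · exact .inl (.inr hB)

theorem extendAt.extends {T T' : SeqTree} {w u : ℕ} {x : Bool} {s : GSeq}
    (h : extendAt T w u x s T') : T.Extends T' := by
  obtain ⟨-, hu, hverts, hroot, hedges, hlab, hvlab⟩ := h
  refine ⟨by simp [hverts], hroot, by simp [hedges], fun a b hab => ?_, fun v hv => ?_⟩
  · have hb : b ≠ u := fun hb => hu (hb ▸ (T.edges_sub _ hab).2)
    simp [hlab, hb]
  · have hvu : v ≠ u := fun hb => hu (hb ▸ hv)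
    simp [SeqTree.ant, hvlab, hvu]

theorem extendAt.edge {T T' : SeqTree} {w u : ℕ} {x : Bool} {s : GSeq}
    (h : extendAt T w u x s T') : (w, u) ∈ T'.edges ∧ T'.elabel w u = x := by
  obtain ⟨-, -, -, -, hedges, hlab, -⟩ := h
  simp [hedges, hlab]

/-- Adding a child that uses up a pending rule application preserves the invariant and
decreases the measure. -/
theorem extendAt_bounded_and_lt {T T' : SeqTree} {w u b : ℕ} {x : Bool} {s : GSeq}
    (hT : Bounded S M T) (h : extendAt T w u x s T') (hbK : b ≤ K) (hd : T.dep w ≤ M)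
    (hs : ∀ A, A ∈ s.1 ∨ A ∈ s.2 → FitsAt S M (T.dep w + 1) A)
    (hp : T'.pending ct cb S w < T.pending ct cb S w) :
    Bounded S M T' ∧ T'.searchMeasure ct cb S M K b < T.searchMeasure ct cb S M K b := by
  have he := h.extends
  have hdu : T'.dep u = T.dep w + 1 := by
    rw [SeqTree.dep_of_edge h.edge.1, he.dep_eq h.1]
  obtain ⟨hw, hu, hverts, hroot, hedges, hlab, hvlab⟩ := h
  have hne : ∀ v ∈ T.verts, v ≠ u := fun v hv hvu => hu (hvu ▸ hv)
  have hant : ∀ v ∈ T.verts, T'.ant v = T.ant v := fun v hv => by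
    simp [SeqTree.ant, hvlab, hne v hv]
  have hsuc : ∀ v ∈ T.verts, T'.suc v = T.suc v := fun v hv => by
    simp [SeqTree.suc, hvlab, hne v hv]
  refine ⟨hT.of_extends he (fun v hv A hA => ?_) (fun v hv hv' => ?_), ?_⟩
  · rw [hant v hv, hsuc v hv] at hA
    exact .inl hA
  · obtain rfl : v = u := by
      rw [hverts] at hv
      exact (Finset.mem_insert.1 hv).resolve_right hv'
    refine ⟨by omega, fun A hA => ?_⟩
    rw [hdu]
    simp only [SeqTree.ant, SeqTree.suc, hvlab, Function.update_self] at hA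
    exact hs A hA
  · unfold SeqTree.searchMeasure
    rw [hverts, Finset.sum_insert hu]
    have h1 : T'.vertexMeasure ct cb S M K b u < measureBase S K ^ (M + 1 - T.dep w) := by
      have := T'.vertexMeasure_lt (ct := ct) (cb := cb) (S := S) (M := M) hbK u
        (j := M - T.dep w) (by omega)
      rwa [show M - T.dep w + 1 = M + 1 - T.dep w by omega] at this
    have h2 : T'.vertexMeasure ct cb S M K b w + measureBase S K ^ (M + 1 - T.dep w) ≤
        T.vertexMeasure ct cb S M K b w := by
      unfold SeqTree.vertexMeasure
      rw [he.dep_eq hw, hant w hw, hsuc w hw]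
      have := Nat.mul_le_mul_left (measureBase S K ^ (M + 1 - T.dep w)) (Nat.succ_le_of_lt hp)
      rw [Nat.succ_eq_add_one, mul_add, mul_one] at this
      omega
    have h3 : ∑ v ∈ T.verts.erase w, T'.vertexMeasure ct cb S M K b v ≤
        ∑ v ∈ T.verts.erase w, T.vertexMeasure ct cb S M K b v :=
      Finset.sum_le_sum fun v hv => he.vertexMeasure_le (Finset.mem_of_mem_erase hv)
        (hsuc v (Finset.mem_of_mem_erase hv)).ge
    rw [← Finset.add_sum_erase _ _ hw, ← Finset.add_sum_erase T.verts _ hw]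
    omega

theorem ImpRRule.bounded_and_lt {T T' : SeqTree} {w b : ℕ} {A B : Fml} (hS : SubfClosed S)
    (hT : Bounded S M T) (h : ImpRRule T w A B T') :
    Bounded S M T' ∧ T'.searchMeasure ct cb S M K b < T.searchMeasure ct cb S M K (b + 1) := by
  obtain ⟨hw, hAB, ⟨hverts, hroot, hedges, hlab⟩, hother, hself⟩ := h
  have hfit := hT.fits w hw _ (.inr hAB)
  have he : T.Extends T' := by
    refine ⟨hverts.ge, hroot, hedges.ge, fun _ _ _ => by rw [hlab], fun v _ => ?_⟩
    by_cases hv : v = w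
    · subst hv; simp [SeqTree.ant, hself]
    · simp [SeqTree.ant, hother v hv]
  refine ⟨hT.of_extends he (fun v _ C hC => ?_) fun v hv hv' => absurd (hverts ▸ hv) hv', ?_⟩
  · by_cases hvw : v = w
    · subst hvw
      simp only [SeqTree.ant, SeqTree.suc, hself, Finset.mem_insert, Finset.mem_singleton] at hC
      rcases hC with (rfl | hC) | rfl
      · exact .inr (hfit.left hS (.inr (.inr rfl)))
      · exact .inl (.inl hC)
      · exact .inr (hfit.right hS (.inr (.inr rfl)))
    · simp only [SeqTree.ant, SeqTree.suc, hother v hvw, Finset.notMem_empty, or_false] at hC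
      exact .inl (.inl hC)
  · unfold SeqTree.searchMeasure
    rw [hverts, Nat.succ_mul]
    have h1 := Finset.sum_le_sum fun v hv =>
      he.vertexMeasure_le_succ (ct := ct) (cb := cb) (S := S) (M := M) (K := K) (b := b) (w := v) hv
    have h2 := pow_pos (measureBase_pos (S := S) (K := K)) (M + 2)
    omega

theorem BoxRRule.bounded_and_lt {T T' : SeqTree} {w u b : ℕ} {x : Bool} {A : Fml}
    (hS : SubfClosed S) (hT : Bounded S M T) (h : BoxRRule T w u x A T') (hbK : b ≤ K) :
    Bounded S M T' ∧ T'.searchMeasure ct cb S M K b < T.searchMeasure ct cb S M K (b + 1) := by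
  obtain ⟨hw, hu, hA, hverts, hroot, hedges, hlab, hold, hnew⟩ := h
  have hfit := (hT.fits w hw _ (.inr hA)).modal hS (.inr rfl) le_rfl
  have he : T.Extends T' := by
    refine ⟨by simp [hverts], hroot, by simp [hedges], fun a b hab => ?_, fun v hv => ?_⟩
    · have hb : b ≠ u := fun hb => hu (hb ▸ (T.edges_sub _ hab).2)
      simp [hlab, hb]
    · simp [SeqTree.ant, hold v hv]
  have hdu : T'.dep u = T.dep w + 1 := by
    rw [SeqTree.dep_of_edge (u := w) (by simp [hedges]), he.dep_eq hw]
  refine ⟨hT.of_extends he (fun v hv C hC => ?_) (fun v hv hv' => ?_), ?_⟩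
  · simp only [SeqTree.ant, SeqTree.suc, hold v hv, Finset.notMem_empty, or_false] at hC
    exact .inl (.inl hC)
  · obtain rfl : v = u := by
      rw [hverts] at hv
      exact (Finset.mem_insert.1 hv).resolve_right hv'
    have := hfit.2
    refine ⟨by omega, fun C hC => ?_⟩
    simp only [SeqTree.ant, SeqTree.suc, hnew, Finset.notMem_empty, Finset.mem_singleton,
      false_or] at hC
    rw [hdu, hC]
    exact hfit
  · unfold SeqTree.searchMeasure
    rw [hverts, Finset.sum_insert hu, Nat.succ_mul]
    have h1 := Finset.sum_le_sum fun v hv =>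
      he.vertexMeasure_le_succ (ct := ct) (cb := cb) (S := S) (M := M) (K := K) (b := b) (w := v) hv
    have h2 := T'.vertexMeasure_lt (ct := ct) (cb := cb) (S := S) (M := M) hbK u
      (j := M + 1) (by omega)
    rw [show M + 1 + 1 = M + 2 from rfl] at h2
    omega

/-- A proof-search step other than `db` preserves the invariant and decreases the measure,
and so does `db` at the cost of one unit of budget. -/
theorem AlgStep.bounded_and_lt {cd : Bool} {m b : ℕ} {T T' : SeqTree} (hS : SubfClosed S)
    (hm : m ≤ M) (hbK : b ≤ K) (hT : Bounded S M T) (h : AlgStep ct cb cd m T T') :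
    (Bounded S M T' ∧ T'.searchMeasure ct cb S M K b < T.searchMeasure ct cb S M K b) ∨
    (Saturated ct cb cd m T ∧ Bounded S M T' ∧
      ∀ c ≤ K, T'.searchMeasure ct cb S M K c < T.searchMeasure ct cb S M K (c + 1)) := by
  rcases h with ⟨w, A, B, hw, hAB, hA, hB, h⟩ | ⟨w, A, B, hw, hAB, hne, h⟩ |
    ⟨w, A, B, hw, hAB, hne, h⟩ | ⟨w, A, B, hw, hAB, hA, hB, h⟩ | ⟨w, A, B, hw, hAB, hA, hB, h⟩ |
    ⟨w, u, x, A, hw, hA, hne, h⟩ | ⟨w, u, x, A, hw, hA, hr, hne, h⟩ |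
    ⟨w, u, x, A, hw, hA, hr, hne, h⟩ | ⟨-, w, u, k, hk, hkm, hne, h⟩ | ⟨hsat, h⟩
  · have hf := hT.fits w hw _ (.inl hAB)
    rcases h with h | h
    · exact .inl (addAnt_bounded_and_lt hT h hA (hf.left hS (.inl rfl)))
    · exact .inl (addAnt_bounded_and_lt hT h hB (hf.right hS (.inl rfl)))
  · have hf := hT.fits w hw _ (.inr hAB)
    refine .inl (updAt_bounded_and_lt hT hw h subset_rfl
      ((Finset.subset_insert _ _).trans (Finset.subset_insert _ _)) (fun he => hne ?_) ?_)
    · have h2 : insert A (insert B (T.suc w)) = T.suc w := congrArg Prod.snd he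
      exact ⟨h2 ▸ by simp, h2 ▸ by simp⟩
    · simp only [Finset.mem_insert]
      rintro C (hC | rfl | rfl | hC)
      · exact .inl (.inl hC)
      · exact .inr (hf.left hS (.inl rfl))
      · exact .inr (hf.right hS (.inl rfl))
      · exact .inl (.inr hC)
  · have hf := hT.fits w hw _ (.inl hAB)
    refine .inl (updAt_bounded_and_lt hT hw h
      ((Finset.subset_insert _ _).trans (Finset.subset_insert _ _)) subset_rfl
      (fun he => hne ?_) ?_)
    · have h2 : insert A (insert B (T.ant w)) = T.ant w := congrArg Prod.fst he
      exact ⟨h2 ▸ by simp, h2 ▸ by simp⟩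
    · simp only [Finset.mem_insert]
      rintro C ((rfl | rfl | hC) | hC)
      · exact .inr (hf.left hS (.inr (.inl rfl)))
      · exact .inr (hf.right hS (.inr (.inl rfl)))
      · exact .inl (.inl hC)
      · exact .inl (.inr hC)
  · have hf := hT.fits w hw _ (.inr hAB)
    rcases h with h | h
    · exact .inl (addSuc_bounded_and_lt hT h hA (hf.left hS (.inr (.inl rfl))))
    · exact .inl (addSuc_bounded_and_lt hT h hB (hf.right hS (.inr (.inl rfl))))
  · have hf := hT.fits w hw _ (.inl hAB)
    rcases h with h | h
    · exact .inl (addSuc_bounded_and_lt hT h hA (hf.left hS (.inr (.inr rfl))))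
    · exact .inl (addAnt_bounded_and_lt hT h hB (hf.right hS (.inr (.inr rfl))))
  · have hf := (hT.fits w hw _ (.inl hA)).modal hS (.inl rfl) le_rfl
    have := hf.2
    refine .inl (extendAt_bounded_and_lt hT h hbK (by omega) ?_ ?_)
    · simp only [Finset.mem_singleton, Finset.notMem_empty, or_false]
      rintro B rfl
      exact hf
    · refine h.extends.pending_lt_of_reach hf.1 hne (.inl h.edge) ?_
      obtain ⟨-, -, -, -, -, -, hvlab⟩ := h
      simp [SeqTree.ant, hvlab]
  · exact .inl (addSuc_bounded_and_lt hT h hne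
      ((hT.fits w hw _ (.inr hA)).modal hS (.inl rfl) hr.dep_le))
  · exact .inl (addAnt_bounded_and_lt hT h hne
      ((hT.fits w hw _ (.inl hA)).modal hS (.inr rfl) hr.dep_le))
  · exact .inl (extendAt_bounded_and_lt hT h hbK (by rw [hk.dep_eq]; omega) (by simp)
      (h.extends.pending_lt_of_edge hne h.edge))
  · rcases h with ⟨w, A, B, h⟩ | ⟨w, u, x, A, h⟩
    · exact .inr ⟨hsat, (h.bounded_and_lt (ct := ct) (cb := cb) (K := K) (b := 0) hS hT).1,
        fun c _ => (h.bounded_and_lt hS hT).2⟩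
    · exact .inr ⟨hsat, (h.bounded_and_lt (ct := ct) (cb := cb) (K := K) hS hT K.zero_le).1,
        fun c hc => (h.bounded_and_lt hS hT hc).2⟩

end Measure

open Classical in
/-- A branch of proof search contains few saturated seq-trees, since no two of them share
a code. -/
theorem card_saturated_le {ct cb cd : Bool} {m M n : ℕ} {S : Finset Fml} {g : ℕ → SeqTree}
    (hb : ∀ i < n, Bounded S M (g i))
    (hh : ∀ i < n, ¬ Halted ct cb cd m ((List.range i).map g) (g i)) :
    ((Finset.range n).filter fun i => Saturated ct cb cd m (g i)).card ≤
      Nat.card (Code S (M + 1)) := by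
  have hlt : ∀ i j, i < j → j < n → Saturated ct cb cd m (g j) →
      (g i).code S (M + 1) (g i).root ≠ (g j).code S (M + 1) (g j).root := by
    intro i j hij hj hsat hc
    have hbi := hb i (hij.trans hj)
    have hbj := hb j hj
    refine hh j hj (.inr (.inr ⟨hsat, g i, ?_, ?_⟩))
    · exact List.mem_map.2 ⟨i, List.mem_range.2 hij, rfl⟩
    · exact SeqTree.exists_strongMorphism_of_code_eq (fun w hw => hbj.subset hw)
        (fun w hw => hbi.subset hw) hbj.dep_le hc.symm
  have := Fintype.ofFinite (Code S (M + 1))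
  rw [Nat.card_eq_fintype_card, ← Finset.card_univ]
  refine Finset.card_le_card_of_injOn (fun i => (g i).code S (M + 1) (g i).root)
    (fun _ _ => Finset.mem_coe.2 (Finset.mem_univ _)) fun i hi j hj hij => ?_
  simp only [Finset.coe_filter, Finset.mem_range, Set.mem_ofPred_eq] at hi hj
  rcases lt_trichotomy i j with h | h | h
  · exact absurd hij (hlt i j h hj.1 hj.2)
  · exact h
  · exact absurd hij.symm (hlt j i h hi.1 hi.2)

/-- Theorem 4.10, termination: `Prove_C` terminates on every
input `I`; the height of the computation tree `ct(I)` is bounded, so `ct(I)`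
is finite: there is a bound `N` such that every branch of proof search (a
sequence of proof-search steps none of whose members is halted, i.e. initial,
stable, or a repeat of an ancestor) has length at most `N`. -/
theorem prove_terminates (ct cb cd : Bool) (I : SeqTree) :
    ∃ N : ℕ, ∀ (g : ℕ → SeqTree) (n : ℕ), g 0 = I →
      (∀ i < n, AlgStep ct cb cd I.mdep (g i) (g (i + 1)) ∧
        ¬ Halted ct cb cd I.mdep ((List.range i).map g) (g i)) →
      n ≤ N := by
  classical
  obtain ⟨M, hmM, hI⟩ := I.exists_bounded I.mdep
  set S := I.subfs
  have hS : SubfClosed S := I.subfClosed_subfs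
  set K := Nat.card (Code S (M + 1))
  refine ⟨I.searchMeasure ct cb S M K K, fun g n h0 hstep => ?_⟩
  have hb : ∀ i ≤ n, Bounded S M (g i) := by
    intro i hi
    induction i with
    | zero => rwa [h0]
    | succ i ih =>
      rcases (hstep i hi).1.bounded_and_lt (K := 0) hS hmM le_rfl (ih (by omega)) with h | h
      · exact h.1
      · exact h.2.1
  let sat := fun i => Saturated ct cb cd I.mdep (g i)
  have key : ∀ i ≤ n, ∃ b, b + ((Finset.range i).filter sat).card ≥ K ∧ b ≤ K ∧
      (g i).searchMeasure ct cb S M K b + i ≤ I.searchMeasure ct cb S M K K := by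
    intro i hi
    induction i with
    | zero => exact ⟨K, by simp, le_rfl, by rw [h0]; rfl⟩
    | succ i ih =>
      obtain ⟨b, hbc, hbK, hle⟩ := ih (by omega)
      have hcard := Finset.card_le_card
        (Finset.filter_subset_filter sat (Finset.range_subset_range.2 (show i ≤ i + 1 by omega)))
      rcases (hstep i hi).1.bounded_and_lt hS hmM hbK (hb i (by omega)) with h | ⟨hsat, -, h⟩
      · exact ⟨b, by omega, hbK, by have := h.2; omega⟩
      · have hle' := card_saturated_le (n := i + 1) (fun j hj => hb j (by omega))
          fun j hj => (hstep j (by omega)).2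
        have hs : ((Finset.range (i + 1)).filter sat).card =
            ((Finset.range i).filter sat).card + 1 := by
          rw [Finset.range_add_one, Finset.filter_insert, if_pos hsat,
            Finset.card_insert_of_notMem (by simp)]
        have hle'' : ((Finset.range (i + 1)).filter sat).card ≤ K := hle'
        obtain ⟨c, rfl⟩ : ∃ c, b = c + 1 := ⟨b - 1, by omega⟩
        exact ⟨c, by omega, by omega, by have := h c (by omega); omega⟩
  obtain ⟨b, -, -, h⟩ := key n le_rfl
  omega
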